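/- Let w be any one of the four Chebyshev weights and let u(x)=(1−x)^γ(1+x)^δ (γ,δ≥0) be a Jacobi weight whose exponents do NOT satisfy conditions (hp-u) relative to w. Then for every constant c1>1 the weighted Lebesgue constants are unbounded: the supremum, over all pairs of integers 0<m<n≤c1·m, of sup_{|x|≤1} Σ_{k=1}^n |Φ_{n,k}^m(w;x)|·u(x)/u(x_k^n) is +∞. (This quantity equals the operator norm of V_n^m acting on C^0_u.) -/

import Mathlib

open Real Set Finset Polynomial

noncomputable section

/-- The four kinds of Chebyshev weights. -/
inductive ChebKind | one | two | three | four

/-- The Chebyshev weight function of each kind. -/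
noncomputable def wFn : ChebKind → ℝ → ℝ
  | .one,   x => 1 / Real.sqrt (1 - x ^ 2)
  | .two,   x => Real.sqrt (1 - x ^ 2)
  | .three, x => Real.sqrt ((1 + x) / (1 - x))
  | .four,  x => Real.sqrt ((1 - x) / (1 + x))

/-- The orthonormal polynomials associated with each Chebyshev weight
(`p_j(w,·)`), expressed via Mathlib's Chebyshev polynomials of the first and
second kind.  On `[-1,1]` these coincide with the usual trigonometric forms. -/
noncomputable def pPoly : ChebKind → ℕ → Polynomial ℝ
  | .one, 0       => Polynomial.C (1 / Real.sqrt π)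
  | .one, (j + 1) => Polynomial.C (Real.sqrt (2 / π)) * Polynomial.Chebyshev.T ℝ ((j : ℤ) + 1)
  | .two, j       => Polynomial.C (Real.sqrt (2 / π)) * Polynomial.Chebyshev.U ℝ (j : ℤ)
  | .three, j     => Polynomial.C (1 / Real.sqrt π) *
      (Polynomial.Chebyshev.U ℝ (j : ℤ) - Polynomial.Chebyshev.U ℝ ((j : ℤ) - 1))
  | .four, j      => Polynomial.C (1 / Real.sqrt π) *
      (Polynomial.Chebyshev.U ℝ (j : ℤ) + Polynomial.Chebyshev.U ℝ ((j : ℤ) - 1))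

noncomputable def pEval (w : ChebKind) (j : ℕ) (x : ℝ) : ℝ := (pPoly w j).eval x

/-- Angular Chebyshev nodes `t_k^n`. -/
noncomputable def tNode : ChebKind → ℕ → ℕ → ℝ
  | .one,   n, k => (2 * (k : ℝ) - 1) * π / (2 * n)
  | .two,   n, k => (k : ℝ) * π / (n + 1)
  | .three, n, k => (2 * (k : ℝ) - 1) * π / (2 * n + 1)
  | .four,  n, k => 2 * (k : ℝ) * π / (2 * n + 1)

/-- Chebyshev nodes `x_k^n = cos t_k^n`, zeros of `p_n(w,·)`. -/
noncomputable def xNode (w : ChebKind) (n k : ℕ) : ℝ := Real.cos (tNode w n k)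

/-- Christoffel numbers `λ_k^n`. -/
noncomputable def lam : ChebKind → ℕ → ℕ → ℝ
  | .one,   n, _ => π / n
  | .two,   n, k => π / (n + 1) * Real.sin (tNode .two n k) ^ 2
  | .three, n, k => 4 * π / (2 * n + 1) * Real.cos (tNode .three n k / 2) ^ 2
  | .four,  n, k => 4 * π / (2 * n + 1) * Real.sin (tNode .four n k / 2) ^ 2

/-- de la Vallée Poussin filter coefficients `μ_{n,j}^m`. -/
noncomputable def mufilt (n m j : ℕ) : ℝ :=
  if j ≤ n - m then 1 else ((n : ℝ) + m - j) / (2 * m)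

/-- Fundamental VP polynomials `Φ_{n,k}^m(w;x)`. -/
noncomputable def Phi (w : ChebKind) (n m k : ℕ) (x : ℝ) : ℝ :=
  lam w n k * ∑ j ∈ Finset.range (n + m), mufilt n m j * pEval w j (xNode w n k) * pEval w j x

/-- The VP interpolation polynomial `V_n^m f`. -/
noncomputable def VP (w : ChebKind) (n m : ℕ) (f : ℝ → ℝ) (x : ℝ) : ℝ :=
  ∑ k ∈ Finset.Icc 1 n, f (xNode w n k) * Phi w n m k x

/-- Jacobi weight `u(x) = (1-x)^γ (1+x)^δ`. -/
noncomputable def jac (γ δ : ℝ) (x : ℝ) : ℝ := (1 - x) ^ γ * (1 + x) ^ δ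

/-- Weighted uniform norm `‖f·u‖ = max_{|x|≤1} |f(x) u(x)|`. -/
noncomputable def wnorm (γ δ : ℝ) (f : ℝ → ℝ) : ℝ :=
  sSup ((fun x => |f x * jac γ δ x|) '' Set.Icc (-1 : ℝ) 1)

/-- Error of best weighted polynomial approximation `E_n(f)_u`. -/
noncomputable def bestE (γ δ : ℝ) (n : ℕ) (f : ℝ → ℝ) : ℝ :=
  sInf ((fun P : Polynomial ℝ => wnorm γ δ (fun x => f x - P.eval x)) ''
    {P : Polynomial ℝ | P.natDegree ≤ n})

/-- Membership in the space `C^0_u`: `f` is continuous on compact subsets of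
`(-1,1)`, `f·u` extends continuously to `[-1,1]`, with value (= limit) `0` at
`±1` when the corresponding exponent is positive. -/
def MemC0 (γ δ : ℝ) (f : ℝ → ℝ) : Prop :=
  ContinuousOn f (Set.Ioo (-1 : ℝ) 1) ∧
  ContinuousOn (fun x => f x * jac γ δ x) (Set.Icc (-1 : ℝ) 1) ∧
  (0 < γ → f 1 * jac γ δ 1 = 0) ∧ (0 < δ → f (-1) * jac γ δ (-1) = 0)

/-- Conditions (hp-u) on the exponents of `u=(1-x)^γ(1+x)^δ` relative to `w`. -/
def hpu : ChebKind → ℝ → ℝ → Prop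
  | .one,   γ, δ => 0 ≤ γ ∧ γ ≤ 1 ∧ 0 ≤ δ ∧ δ ≤ 1
  | .two,   γ, δ => 0 < γ ∧ γ ≤ 3 / 2 ∧ 0 < δ ∧ δ ≤ 3 / 2 ∧ -1 ≤ γ - δ ∧ γ - δ ≤ 1
  | .three, γ, δ => 0 ≤ γ ∧ γ ≤ 1 ∧ 0 < δ ∧ δ ≤ 3 / 2 ∧ γ - δ ≤ 1 / 2
  | .four,  γ, δ => 0 < γ ∧ γ ≤ 3 / 2 ∧ 0 ≤ δ ∧ δ ≤ 1 ∧ -(1 / 2) ≤ γ - δ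

/-- `φ(x) = sqrt(1-x²)`. -/
noncomputable def phi (x : ℝ) : ℝ := Real.sqrt (1 - x ^ 2)

/-- The set of values `|f^{(r)}(x)| φ(x)^r u(x)`, `x ∈ (-1,1)`. -/
noncomputable def derSet (γ δ : ℝ) (r : ℕ) (f : ℝ → ℝ) : Set ℝ :=
  (fun x : ℝ => |iteratedDerivWithin r f (Set.Ioo (-1 : ℝ) 1) x| * phi x ^ r * jac γ δ x) ''
    Set.Ioo (-1 : ℝ) 1

/-- Membership in the Sobolev-type space `W_r(u)`. -/
def MemW (γ δ : ℝ) (r : ℕ) (f : ℝ → ℝ) : Prop :=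
  MemC0 γ δ f ∧ ContDiffOn ℝ r f (Set.Ioo (-1 : ℝ) 1) ∧ BddAbove (derSet γ δ r f)

/-- The norm of `W_r(u)`: `‖fu‖ + ‖f^{(r)} φ^r u‖`. -/
noncomputable def Wnorm (γ δ : ℝ) (r : ℕ) (f : ℝ → ℝ) : ℝ :=
  wnorm γ δ f + sSup (derSet γ δ r f)

/-- The set of values `(n+1)^r E_n(f)_u`, `n ≥ 1`. -/
noncomputable def zSet (γ δ r : ℝ) (f : ℝ → ℝ) : Set ℝ :=
  (fun n : ℕ => ((n : ℝ) + 1) ^ r * bestE γ δ n f) '' {n : ℕ | 1 ≤ n}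

/-- Membership in the Hölder–Zygmund space `Z_r(u)`. -/
def MemZ (γ δ r : ℝ) (f : ℝ → ℝ) : Prop := MemC0 γ δ f ∧ BddAbove (zSet γ δ r f)

/-- The norm of `Z_r(u)`: `‖fu‖ + sup_{n≥1} (n+1)^r E_n(f)_u`. -/
noncomputable def Znorm (γ δ r : ℝ) (f : ℝ → ℝ) : ℝ :=
  wnorm γ δ f + sSup (zSet γ δ r f)

/-- Exponents `(γ,δ)` of the weight `u = sqrt(w·φ)`. -/
def uExp : ChebKind → ℝ × ℝ
  | .one => (0, 0) | .two => (1 / 2, 1 / 2) | .three => (0, 1 / 2) | .four => (1 / 2, 0)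

/-- The constant `C_w`. -/
def Cw : ChebKind → ℝ | .one => 2 | _ => 1

/-- The quantity `n_w`. -/
noncomputable def nw : ChebKind → ℕ → ℝ
  | .one, n => n | .two, n => n + 1
  | .three, n => (2 * (n : ℝ) + 1) / 2 | .four, n => (2 * (n : ℝ) + 1) / 2

/-- The quantity `m_w`. -/
noncomputable def mw : ChebKind → ℕ → ℕ → ℝ
  | .one, n, m => (n : ℝ) + m | .two, n, m => (n : ℝ) + m
  | .three, n, m => 2 * ((n : ℝ) + m) - 1 | .four, n, m => 2 * ((n : ℝ) + m) - 1

/-- The polynomials `q_{n,j}^m(w,·)` (orthogonal VP basis). -/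
noncomputable def qq (w : ChebKind) (n m j : ℕ) (x : ℝ) : ℝ :=
  if j ≤ n - m then pEval w j x
  else ((m : ℝ) + n - j) / (2 * m) * pEval w j x
    - ((m : ℝ) + j - n) / (2 * m) * pEval w (2 * n - j) x

end

/-- The offset `nw w n - n` of the frequencies belonging to each weight. -/
noncomputable def freqShift : ChebKind → ℝ
  | .one => 0 | .two => 1 | .three => 1 / 2 | .four => 1 / 2

/-- The trigonometric denominator of the orthonormal polynomials. -/
noncomputable def trigDen : ChebKind → ℝ → ℝ
  | .one, _ => 1 | .two, t => Real.sin t | .three, t => Real.cos (t / 2)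
  | .four, t => Real.sin (t / 2)

/-- The trigonometric function in the numerator of the orthonormal polynomials. -/
noncomputable def trigNum : ChebKind → ℝ → ℝ
  | .one, t => Real.cos t | .two, t => Real.sin t | .three, t => Real.cos t
  | .four, t => Real.sin t

/-- The normalization factor of the orthonormal polynomials. -/
noncomputable def trigNorm : ChebKind → ℝ
  | .one => Real.sqrt (2 / π) | .two => Real.sqrt (2 / π)
  | .three => 1 / Real.sqrt π | .four => 1 / Real.sqrt π

theorem nw_eq (w : ChebKind) (n : ℕ) : nw w n = n + freqShift w := by
  cases w <;> simp [nw, freqShift] <;> ring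

theorem pEval_cos_mul (w : ChebKind) (j : ℕ) (hw : w = .one → j ≠ 0) {t : ℝ} (h0 : 0 < t)
    (h1 : t < π) :
    pEval w j (Real.cos t) * trigDen w t = trigNorm w * trigNum w ((j + freqShift w) * t) := by
  have hs : Real.sin t = 2 * Real.sin (t / 2) * Real.cos (t / 2) := by
    rw [← Real.sin_two_mul]; congr 1; ring
  have hs2 : 0 < Real.sin (t / 2) := Real.sin_pos_of_pos_of_lt_pi (by linarith) (by linarith)
  have hc2 : 0 < Real.cos (t / 2) := Real.cos_pos_of_mem_Ioo ⟨by linarith, by linarith⟩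
  have hU := Polynomial.Chebyshev.U_real_cos t (j : ℤ)
  have hU' := Polynomial.Chebyshev.U_real_cos t ((j : ℤ) - 1)
  push_cast at hU hU'
  have e1 : ((j : ℝ) + 1) * t = (j + 1 / 2) * t + t / 2 := by ring
  have e2 : ((j : ℝ) - 1 + 1) * t = (j + 1 / 2) * t - t / 2 := by ring
  cases w with
  | one =>
    obtain ⟨i, rfl⟩ := Nat.exists_eq_succ_of_ne_zero (hw rfl)
    have hT := Polynomial.Chebyshev.T_real_cos t ((i : ℤ) + 1)
    push_cast at hT
    simp [pEval, pPoly, trigDen, trigNum, trigNorm, freqShift, hT]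
  | two =>
    simp only [pEval, pPoly, trigDen, trigNum, trigNorm, freqShift, Polynomial.eval_mul,
      Polynomial.eval_C]
    rw [mul_assoc, hU]
  | three =>
    simp only [pEval, pPoly, trigDen, trigNum, trigNorm, freqShift, Polynomial.eval_mul,
      Polynomial.eval_C, Polynomial.eval_sub]
    rw [e1, Real.sin_add] at hU
    rw [e2, Real.sin_sub] at hU'
    rw [mul_assoc]
    congr 1
    refine mul_left_cancel₀ (mul_ne_zero two_ne_zero hs2.ne') ?_
    linear_combination hU - hU' - (Polynomial.eval (Real.cos t) (Polynomial.Chebyshev.U ℝ (j : ℤ)) -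
      Polynomial.eval (Real.cos t) (Polynomial.Chebyshev.U ℝ ((j : ℤ) - 1))) * hs
  | four =>
    simp only [pEval, pPoly, trigDen, trigNum, trigNorm, freqShift, Polynomial.eval_mul,
      Polynomial.eval_C, Polynomial.eval_add]
    rw [e1, Real.sin_add] at hU
    rw [e2, Real.sin_sub] at hU'
    rw [mul_assoc]
    congr 1
    refine mul_left_cancel₀ (mul_ne_zero two_ne_zero hc2.ne') ?_
    linear_combination hU + hU' - (Polynomial.eval (Real.cos t) (Polynomial.Chebyshev.U ℝ (j : ℤ)) +
      Polynomial.eval (Real.cos t) (Polynomial.Chebyshev.U ℝ ((j : ℤ) - 1))) * hs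

theorem lam_mul_trigNorm_sq (w : ChebKind) {n : ℕ} (hn : 0 < n) (k : ℕ) :
    lam w n k * trigNorm w ^ 2 = 2 / nw w n * trigDen w (tNode w n k) ^ 2 := by
  have hp := Real.pi_pos
  have hn' : (0 : ℝ) < n := by exact_mod_cast hn
  cases w <;> simp only [lam, trigNorm, nw, trigDen, div_pow, one_pow, Real.sq_sqrt hp.le,
    Real.sq_sqrt (div_nonneg zero_le_two hp.le)] <;> field_simp <;> ring

theorem sum_cos_mul (a s : ℝ) (L : ℕ) :
    (∑ j ∈ Finset.range L, Real.cos ((j + a) * s)) * (2 * (1 - Real.cos s)) =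
      Real.cos (a * s) - Real.cos ((a - 1) * s) + Real.cos ((L - 1 + a) * s)
        - Real.cos ((L + a) * s) := by
  induction L with
  | zero =>
    simp only [Finset.range_zero, Finset.sum_empty, zero_mul, Nat.cast_zero]
    rw [show (0 - 1 + a) * s = (a - 1) * s by ring, zero_add]; ring
  | succ L ih =>
    rw [Finset.sum_range_succ, add_mul, ih]
    push_cast
    rw [show ((L : ℝ) + 1 - 1 + a) * s = (L + a) * s by ring,
      show ((L : ℝ) - 1 + a) * s = (L + a) * s - s by ring,
      show ((L : ℝ) + 1 + a) * s = (L + a) * s + s by ring, Real.cos_add, Real.cos_sub]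
    ring

theorem sum_sub_mul_cos_mul (a s : ℝ) (L : ℕ) :
    (∑ j ∈ Finset.range L, ((L : ℝ) - j) * Real.cos ((j + a) * s)) * (2 * (1 - Real.cos s)) =
      L * (Real.cos (a * s) - Real.cos ((a - 1) * s)) + Real.cos (a * s)
        - Real.cos ((L + a) * s) := by
  induction L with
  | zero => simp
  | succ L ih =>
    have h : ∑ j ∈ Finset.range (L + 1), (((L + 1 : ℕ) : ℝ) - j) * Real.cos ((j + a) * s) =
        ∑ j ∈ Finset.range L, ((L : ℝ) - j) * Real.cos ((j + a) * s) +
          ∑ j ∈ Finset.range (L + 1), Real.cos ((j + a) * s) := by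
      rw [Finset.sum_range_succ, Finset.sum_range_succ _ L, ← add_assoc, ← Finset.sum_add_distrib]
      congr 1
      · refine Finset.sum_congr rfl fun j _ => ?_
        push_cast; ring
      · push_cast; ring
    rw [h, add_mul, ih, sum_cos_mul]
    push_cast
    rw [show ((L : ℝ) + 1 - 1 + a) * s = (L + a) * s by ring]
    ring

theorem sum_mufilt_mul {n m : ℕ} (hm : 0 < m) (hmn : m < n) (f : ℕ → ℝ) :
    2 * m * ∑ j ∈ Finset.range (n + m), mufilt n m j * f j =
      ∑ j ∈ Finset.range (n + m), (((n + m : ℕ) : ℝ) - j) * f j -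
        ∑ j ∈ Finset.range (n - m), (((n - m : ℕ) : ℝ) - j) * f j := by
  have hm' : (m : ℝ) ≠ 0 := by exact_mod_cast hm.ne'
  have h : ∑ j ∈ Finset.range (n - m), (((n - m : ℕ) : ℝ) - j) * f j =
      ∑ j ∈ Finset.range (n + m), if j < n - m then (((n - m : ℕ) : ℝ) - j) * f j else 0 := by
    rw [← Finset.sum_filter]
    refine Finset.sum_congr ?_ fun _ _ => rfl
    ext j; simp; omega
  rw [h, Finset.mul_sum, ← Finset.sum_sub_distrib]
  refine Finset.sum_congr rfl fun j _ => ?_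
  have hc : ((n - m : ℕ) : ℝ) = n - m := Nat.cast_sub hmn.le
  unfold mufilt
  by_cases h1 : j < n - m
  · rw [if_pos h1.le, if_pos h1, hc]; push_cast; ring
  · by_cases h2 : j ≤ n - m
    · have : j = n - m := by omega
      rw [if_pos h2, if_neg h1, this, hc]; push_cast; ring
    · rw [if_neg h2, if_neg h1]; push_cast; field_simp; ring

/-- Closed form of the de la Vallée Poussin kernel. -/
theorem sum_mufilt_mul_cos {n m : ℕ} (hm : 0 < m) (hmn : m < n) (a s : ℝ) :
    (∑ j ∈ Finset.range (n + m), mufilt n m j * Real.cos ((j + a) * s)) * (2 * (1 - Real.cos s)) =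
      Real.cos (a * s) - Real.cos ((a - 1) * s) + Real.sin ((n + a) * s) * Real.sin (m * s) / m := by
  have hm' : (m : ℝ) ≠ 0 := by exact_mod_cast hm.ne'
  have h := congrArg (· * (2 * (1 - Real.cos s)))
    (sum_mufilt_mul hm hmn fun j => Real.cos ((j + a) * s))
  simp only [sub_mul (_ : ℝ) _ (2 * (1 - Real.cos s)), sum_sub_mul_cos_mul] at h
  have hc : ((n - m : ℕ) : ℝ) = n - m := Nat.cast_sub hmn.le
  rw [hc] at h
  push_cast at h
  rw [show ((n : ℝ) + m + a) * s = (n + a) * s + m * s by ring,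
    show ((n : ℝ) - m + a) * s = (n + a) * s - m * s by ring, Real.cos_add, Real.cos_sub] at h
  generalize Real.sin ((n + a) * s) = A at h ⊢
  generalize Real.sin (m * s) = B at h ⊢
  refine mul_left_cancel₀ (mul_ne_zero two_ne_zero hm') ?_
  have hB : (m : ℝ) * (A * B / m) = A * B := mul_div_cancel₀ _ hm'
  linear_combination h - 2 * hB

/-- The sign in the product-to-sum formula for `trigNum`. -/
noncomputable def trigSign : ChebKind → ℝ
  | .one => 1 | .two => -1 | .three => 1 | .four => -1

/-- The correction caused by the constant polynomial of the first-kind weight. -/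
noncomputable def constCorr : ChebKind → ℝ
  | .one => 1 | _ => 0

theorem two_mul_trigNum_mul (w : ChebKind) (x y : ℝ) :
    2 * (trigNum w x * trigNum w y) = Real.cos (y - x) + trigSign w * Real.cos (y + x) := by
  cases w <;> simp only [trigNum, trigSign, Real.cos_sub, Real.cos_add] <;> ring

theorem trigDen_pos (w : ChebKind) {t : ℝ} (h0 : 0 < t) (h1 : t < π) : 0 < trigDen w t := by
  cases w
  · exact one_pos
  · exact Real.sin_pos_of_pos_of_lt_pi h0 h1
  · exact Real.cos_pos_of_mem_Ioo ⟨by linarith, by linarith⟩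
  · exact Real.sin_pos_of_pos_of_lt_pi (by linarith) (by linarith)

theorem nw_pos (w : ChebKind) {n : ℕ} (hn : 0 < n) : 0 < nw w n := by
  have hn' : (0 : ℝ) < n := by exact_mod_cast hn
  cases w <;> simp only [nw] <;> positivity

theorem tNode_mem (w : ChebKind) {n k : ℕ} (hk : 1 ≤ k) (hkn : k ≤ n) :
    0 < tNode w n k ∧ tNode w n k < π := by
  have hp := Real.pi_pos
  have hk' : (1 : ℝ) ≤ k := by exact_mod_cast hk
  have hkn' : (k : ℝ) ≤ n := by exact_mod_cast hkn
  have hn : (0 : ℝ) < n := by linarith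
  cases w <;> simp only [tNode] <;> refine ⟨div_pos ?_ (by positivity), ?_⟩
  · exact mul_pos (by linarith) hp
  · rw [div_lt_iff₀ (by positivity)]; nlinarith
  · positivity
  · rw [div_lt_iff₀ (by positivity)]; nlinarith
  · exact mul_pos (by linarith) hp
  · rw [div_lt_iff₀ (by positivity)]; nlinarith
  · positivity
  · rw [div_lt_iff₀ (by positivity)]; nlinarith

theorem nw_mul_Phi_mul (w : ChebKind) {n m k : ℕ} (hk : 1 ≤ k) (hkn : k ≤ n)
    {t : ℝ} (h0 : 0 < t) (h1 : t < π) :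
    nw w n * Phi w n m k (Real.cos t) * trigDen w t = trigDen w (tNode w n k) *
      (2 * ∑ j ∈ Finset.range (n + m), mufilt n m j * (trigNum w ((j + freqShift w) * tNode w n k) *
        trigNum w ((j + freqShift w) * t)) - constCorr w) := by
  obtain ⟨k0, k1⟩ := tNode_mem w hk hkn
  have hd := trigDen_pos w k0 k1
  have hn : 0 < n := by omega
  have hN := nw_pos w hn
  set s := tNode w n k with hs
  have hdiff : (∑ j ∈ Finset.range (n + m), (mufilt n m j * (pEval w j (Real.cos s) * trigDen w s) *
        (pEval w j (Real.cos t) * trigDen w t) - trigNorm w ^ 2 * (mufilt n m j *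
        (trigNum w ((j + freqShift w) * s) * trigNum w ((j + freqShift w) * t))))) =
      - constCorr w * (trigNorm w ^ 2 / 2) := by
    rw [Finset.sum_eq_single 0]
    · cases w with
      | one =>
        have h2 : 1 / Real.sqrt π * (1 / Real.sqrt π) = 1 / π := by
          rw [div_mul_div_comm, Real.mul_self_sqrt Real.pi_pos.le, one_mul]
        have h3 := Real.sq_sqrt (div_nonneg zero_le_two Real.pi_pos.le)
        have h4 : ∀ x, pEval .one 0 x = 1 / Real.sqrt π := fun x => by simp [pEval, pPoly]
        simp only [h4, trigDen, trigNum, trigNorm, freqShift, constCorr, mufilt, Nat.zero_le,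
          if_true, Nat.cast_zero, add_zero, zero_mul, Real.cos_zero, h3]
        linear_combination h2
      | _ =>
        rw [pEval_cos_mul _ _ (by simp) h0 h1, pEval_cos_mul _ _ (by simp) k0 k1]
        simp only [constCorr]
        ring
    · intro j _ hj
      rw [pEval_cos_mul _ _ (fun _ => hj) h0 h1, pEval_cos_mul _ _ (fun _ => hj) k0 k1]
      ring
    · intro h; simp at h; omega
  rw [Finset.sum_sub_distrib, ← Finset.mul_sum] at hdiff
  have hl := lam_mul_trigNorm_sq w hn k
  rw [← hs] at hl
  have hPhi : Phi w n m k (Real.cos t) * trigDen w t * trigDen w s = lam w n k *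
      ∑ j ∈ Finset.range (n + m), (mufilt n m j * (pEval w j (Real.cos s) * trigDen w s) *
        (pEval w j (Real.cos t) * trigDen w t)) := by
    rw [Phi, xNode, ← hs, mul_assoc, mul_assoc, Finset.sum_mul]
    congr 1
    refine Finset.sum_congr rfl fun j _ => ?_
    ring
  rw [sub_eq_iff_eq_add] at hdiff
  rw [hdiff] at hPhi
  refine mul_right_cancel₀ hd.ne' ?_
  have hl' : nw w n * (lam w n k * trigNorm w ^ 2) = 2 * trigDen w s ^ 2 := by
    rw [hl]; field_simp
  generalize (∑ j ∈ Finset.range (n + m), mufilt n m j * (trigNum w ((j + freqShift w) * s) *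
        trigNum w ((j + freqShift w) * t))) = S at hPhi ⊢
  linear_combination nw w n * hPhi + (S - constCorr w / 2) * hl'

theorem nw_mul_tNode (w : ChebKind) {n : ℕ} (hn : 0 < n) (k : ℕ) :
    nw w n * tNode w n k = (k - (1 + trigSign w) / 4) * π := by
  have hn' : (0 : ℝ) < n := by exact_mod_cast hn
  cases w <;> simp only [nw, tNode, trigSign] <;> field_simp <;> ring

theorem exists_sign_sin_nodes (w : ChebKind) {n m k : ℕ} (hn : 0 < n) {t : ℝ}
    (ht : Real.sin (m * t) = 0) :
    ∃ c : ℝ, |c| = 1 ∧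
      Real.sin (nw w n * (t - tNode w n k)) * Real.sin (m * (t - tNode w n k)) =
        c * (trigNum w (nw w n * t) * Real.sin (m * tNode w n k)) ∧
      trigSign w *
        (Real.sin (nw w n * (t + tNode w n k)) * Real.sin (m * (t + tNode w n k))) =
        c * (trigNum w (nw w n * t) * Real.sin (m * tNode w n k)) := by
  have hN := nw_mul_tNode w hn k
  have hsk : Real.sin (k * π) = 0 := Real.sin_nat_mul_pi k
  have hck : |Real.cos (k * π)| = 1 := by exact_mod_cast Real.abs_cos_int_mul_pi (k : ℤ)
  have hcm : |Real.cos (m * t)| = 1 := by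
    have := Real.sin_sq_add_cos_sq (m * t)
    rw [ht] at this
    rw [← sq_eq_sq₀ (abs_nonneg _) zero_le_one, sq_abs]; linarith
  have hhalf : ∀ x : ℝ, x = (k - (1 + 1) / 4) * π → Real.cos x = 0 ∧ |Real.sin x| = 1 := by
    rintro x rfl
    rw [show ((k : ℝ) - (1 + 1) / 4) * π = k * π - π / 2 by ring, Real.cos_sub_pi_div_two,
      Real.sin_sub_pi_div_two, abs_neg]
    exact ⟨hsk, hck⟩
  have hint : ∀ x : ℝ, x = (k - (1 + -1) / 4) * π → Real.sin x = 0 ∧ |Real.cos x| = 1 := by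
    rintro x rfl
    rw [show ((k : ℝ) - (1 + -1) / 4) * π = k * π by ring]
    exact ⟨hsk, hck⟩
  simp only [mul_sub, mul_add, Real.sin_sub, Real.sin_add, ht]
  cases w
  case one | three =>
    simp only [trigSign, trigNum] at hN ⊢
    obtain ⟨h1, h2⟩ := hhalf _ hN
    refine ⟨Real.sin _ * Real.cos (m * t), by rw [abs_mul, h2, hcm, one_mul], ?_, ?_⟩ <;> rw [h1] <;> ring
  case two | four =>
    simp only [trigSign, trigNum] at hN ⊢
    obtain ⟨h1, h2⟩ := hint _ hN
    refine ⟨-(Real.cos _ * Real.cos (m * t)), by rw [abs_neg, abs_mul, h2, hcm, one_mul], ?_, ?_⟩ <;> rw [h1] <;> ring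

theorem cos_lt_one_of_pos {s : ℝ} (h0 : 0 < s) (h1 : s < 2 * π) : Real.cos s < 1 := by
  refine lt_of_le_of_ne (Real.cos_le_one s) fun h => ?_
  rw [Real.cos_eq_one_iff_of_lt_of_lt (by linarith [Real.pi_pos]) h1] at h
  exact h0.ne' h

theorem cos_sub_lt_one {s t : ℝ} (hs0 : 0 < s) (hs1 : s < π) (h0 : 0 < t) (h1 : t < π)
    (h : t ≠ s) : Real.cos (t - s) < 1 := by
  rcases lt_or_gt_of_ne h with h | h
  · rw [← Real.cos_neg]; exact cos_lt_one_of_pos (by linarith) (by linarith)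
  · exact cos_lt_one_of_pos (by linarith) (by linarith)

theorem abs_Phi_cos (w : ChebKind) {n m k : ℕ} (hm : 0 < m) (hmn : m < n) (hk : 1 ≤ k)
    (hkn : k ≤ n) {t : ℝ} (h0 : 0 < t) (h1 : t < π) (hne : t ≠ tNode w n k)
    (ht : Real.sin (m * t) = 0) :
    |Phi w n m k (Real.cos t)| = trigDen w (tNode w n k) * |trigNum w (nw w n * t)| *
      |Real.sin (m * tNode w n k)| / (2 * nw w n * m * trigDen w t) *
        (1 / (1 - Real.cos (t - tNode w n k)) + 1 / (1 - Real.cos (t + tNode w n k))) := by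
  obtain ⟨k0, k1⟩ := tNode_mem w hk hkn
  have hdk := trigDen_pos w k0 k1
  have hd := trigDen_pos w h0 h1
  have hn : 0 < n := by omega
  have hN := nw_pos w hn
  have hm' : (0 : ℝ) < m := by exact_mod_cast hm
  have hPhi := nw_mul_Phi_mul (m := m) w hk hkn h0 h1
  obtain ⟨c, hc, hc1, hc2⟩ := exists_sign_sin_nodes w (k := k) hn ht
  set s := tNode w n k with hs
  have hD1 : 0 < 1 - Real.cos (t - s) := by linarith [cos_sub_lt_one k0 k1 h0 h1 hne]
  have hD2 : 0 < 1 - Real.cos (t + s) := by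
    linarith [cos_lt_one_of_pos (s := t + s) (by linarith) (by linarith)]
  have hG1 := sum_mufilt_mul_cos hm hmn (freqShift w) (t - s)
  have hG2 := sum_mufilt_mul_cos hm hmn (freqShift w) (t + s)
  have hsum : 2 * ∑ j ∈ Finset.range (n + m), mufilt n m j *
        (trigNum w ((j + freqShift w) * s) * trigNum w ((j + freqShift w) * t)) =
      (∑ j ∈ Finset.range (n + m), mufilt n m j * Real.cos ((j + freqShift w) * (t - s))) +
      trigSign w *
        ∑ j ∈ Finset.range (n + m), mufilt n m j * Real.cos ((j + freqShift w) * (t + s)) := by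
    rw [Finset.mul_sum, Finset.mul_sum, ← Finset.sum_add_distrib]
    refine Finset.sum_congr rfl fun j _ => ?_
    have := two_mul_trigNum_mul w ((j + freqShift w) * s) ((j + freqShift w) * t)
    rw [← mul_sub, ← mul_add] at this
    linear_combination mufilt n m j * this
  rw [hsum] at hPhi
  rw [← nw_eq] at hG1 hG2
  rw [hc1] at hG1
  generalize (∑ j ∈ Finset.range (n + m), mufilt n m j *
    Real.cos ((j + freqShift w) * (t - s))) = G1 at hPhi hG1
  generalize (∑ j ∈ Finset.range (n + m), mufilt n m j *
    Real.cos ((j + freqShift w) * (t + s))) = G2 at hPhi hG2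
  have hG2' : trigSign w * G2 * (2 * (1 - Real.cos (t + s))) = trigSign w *
      (Real.cos (freqShift w * (t + s)) - Real.cos ((freqShift w - 1) * (t + s))) +
      c * (trigNum w (nw w n * t) * Real.sin (m * s)) / m := by
    rw [mul_assoc, hG2, mul_add, ← hc2]; ring
  set P := trigNum w (nw w n * t) * Real.sin (m * s) with hP
  have hbd : ∀ x : ℝ, Real.cos (freqShift w * x) - Real.cos ((freqShift w - 1) * x) =
      (1 - 2 * freqShift w) * (1 - Real.cos x) := by
    intro x
    cases w <;> simp only [freqShift]
    · simp
    · simp; ring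
    · rw [show (1 / 2 - 1) * x = -(1 / 2 * x) by ring, Real.cos_neg]; ring
    · rw [show (1 / 2 - 1) * x = -(1 / 2 * x) by ring, Real.cos_neg]; ring
  rw [hbd] at hG1 hG2'
  have e1 : G1 = (1 - 2 * freqShift w) / 2 + c * P / (2 * m) * (1 / (1 - Real.cos (t - s))) := by
    field_simp at hG1 ⊢; linear_combination hG1
  have e2 : trigSign w * G2 = trigSign w * ((1 - 2 * freqShift w) / 2) +
      c * P / (2 * m) * (1 / (1 - Real.cos (t + s))) := by
    field_simp at hG2' ⊢; linear_combination hG2'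
  have hcorr : (1 + trigSign w) * ((1 - 2 * freqShift w) / 2) = constCorr w := by
    cases w <;> norm_num [trigSign, freqShift, constCorr]
  rw [e2, e1] at hPhi
  have hfin : Phi w n m k (Real.cos t) = c * (trigDen w s * P / (2 * nw w n * m * trigDen w t) *
      (1 / (1 - Real.cos (t - s)) + 1 / (1 - Real.cos (t + s)))) := by
    have h3 : Phi w n m k (Real.cos t) = (nw w n * Phi w n m k (Real.cos t) * trigDen w t) /
      (nw w n * trigDen w t) := by field_simp
    rw [h3, hPhi, ← hcorr]
    generalize 1 / (1 - Real.cos (t - s)) = A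
    generalize 1 / (1 - Real.cos (t + s)) = B
    field_simp
    ring
  have hA : 0 < 1 / (1 - Real.cos (t - s)) + 1 / (1 - Real.cos (t + s)) := by positivity
  rw [hfin, abs_mul, hc, one_mul, abs_mul, abs_of_pos hA, abs_div, abs_mul, hP, abs_mul,
    abs_of_pos hdk, abs_of_pos (by positivity : 0 < 2 * nw w n * m * trigDen w t), ← mul_assoc]

/-- The base value of the frequency multiplier, fixing the parity required by each weight. -/
def freqBase : ChebKind → ℕ
  | .one => 2 | .two => 2 | .three => 3 | .four => 3

/-- Pairs `(n, m)` for which `nw w n / m = (2 r + 1) / (2 r)` exactly. -/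
structure Admissible (w : ChebKind) (r l n m q : ℕ) : Prop where
  m_lt : m < n
  m_eq : m = r * q
  q_eq : q = freqBase w + 2 * r * l
  two_mul_nw : 2 * nw w n = (2 * r + 1) * q

theorem exists_admissible (w : ChebKind) {r l : ℕ} (hr : 1 ≤ r) (hl : 1 ≤ l) :
    ∃ n m q, Admissible w r l n m q := by
  have h1 : 1 ≤ r * l := Nat.mul_pos hr hl
  have h2 : r ≤ r * (r * l) := Nat.le_mul_of_pos_right r h1
  cases w
  · refine ⟨(2 * r + 1) * (1 + r * l), _, _, ?_, rfl, rfl, ?_⟩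
    · simp only [freqBase]; nlinarith
    · simp only [freqBase, nw]; push_cast; ring
  · have h3 : (2 * r + 1) * (1 + r * l) - 1 + 1 = (2 * r + 1) * (1 + r * l) :=
      Nat.sub_add_cancel (Nat.mul_pos (by omega) (by omega))
    refine ⟨(2 * r + 1) * (1 + r * l) - 1, _, _, ?_, rfl, rfl, ?_⟩
    · simp only [freqBase]; nlinarith
    · have h4 := congrArg (Nat.cast (R := ℝ)) h3
      push_cast at h4
      simp only [freqBase, nw]; push_cast
      rw [h4]; ring
  · refine ⟨(2 * r + 1) * (1 + r * l) + r, _, _, ?_, rfl, rfl, ?_⟩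
    · simp only [freqBase]; nlinarith
    · simp only [freqBase, nw]; push_cast; ring
  · refine ⟨(2 * r + 1) * (1 + r * l) + r, _, _, ?_, rfl, rfl, ?_⟩
    · simp only [freqBase]; nlinarith
    · simp only [freqBase, nw]; push_cast; ring

/-- The phase `m * tNode w n 1` of the first node, for admissible pairs. -/
noncomputable def firstPhase (w : ChebKind) (r : ℕ) : ℝ :=
  2 * r / (2 * r + 1) * ((3 - trigSign w) / 4 * π)

theorem sin_firstPhase_pos (w : ChebKind) {r : ℕ} (hr : 1 ≤ r) :
    0 < Real.sin (firstPhase w r) := by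
  have hp := Real.pi_pos
  have hr' : (1 : ℝ) ≤ r := by exact_mod_cast hr
  have h1 : (2 * r / (2 * r + 1) : ℝ) < 1 := by rw [div_lt_one (by positivity)]; linarith
  have h0 : (0 : ℝ) < 2 * r / (2 * r + 1) := by positivity
  have h2 : 0 < (3 - trigSign w) / 4 * π ∧ (3 - trigSign w) / 4 * π ≤ π := by
    cases w <;> simp only [trigSign] <;> constructor <;> linarith
  unfold firstPhase
  exact Real.sin_pos_of_pos_of_lt_pi (mul_pos h0 h2.1) (by nlinarith [h2.1, h2.2])

section Admissible

variable {w : ChebKind} {r l n m q : ℕ}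

theorem Admissible.pos (h : Admissible w r l n m q) (hr : 1 ≤ r) :
    0 < q ∧ 0 < m ∧ 0 < n := by
  have hq : 0 < q := by
    rw [h.q_eq]; have : 0 < freqBase w := by cases w <;> simp [freqBase]
    omega
  have hm : 0 < m := by rw [h.m_eq]; exact Nat.mul_pos hr hq
  exact ⟨hq, hm, hm.trans h.m_lt⟩

theorem Admissible.two_mul_mul_nw (h : Admissible w r l n m q) :
    2 * r * nw w n = (2 * r + 1) * m := by
  have := h.two_mul_nw
  rw [h.m_eq]; push_cast
  linear_combination (r : ℝ) * this

theorem Admissible.le_nw (h : Admissible w r l n m q) (hr : 1 ≤ r) : (m : ℝ) ≤ nw w n := by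
  have h1 := h.two_mul_mul_nw
  have hr' : (1 : ℝ) ≤ r := by exact_mod_cast hr
  have hm : (0 : ℝ) ≤ m := m.cast_nonneg
  nlinarith

theorem Admissible.l_le_nw (h : Admissible w r l n m q) (hr : 1 ≤ r) : (l : ℝ) ≤ nw w n := by
  refine le_trans ?_ (h.le_nw hr)
  have : l ≤ m := by
    rw [h.m_eq, h.q_eq]
    have : l ≤ r * l := Nat.le_mul_of_pos_left l hr
    have h2 : r * l ≤ r * (r * l) := Nat.le_mul_of_pos_left _ hr
    nlinarith
  exact_mod_cast this

theorem Admissible.mul_tNode_one (h : Admissible w r l n m q) (hr : 1 ≤ r) :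
    m * tNode w n 1 = firstPhase w r := by
  obtain ⟨-, -, hn⟩ := h.pos hr
  have h1 := h.two_mul_mul_nw
  have h2 := nw_mul_tNode w hn 1
  have hr' : (0 : ℝ) < 2 * r + 1 := by positivity
  unfold firstPhase
  push_cast at h2
  field_simp
  linear_combination (-4 * tNode w n 1) * h1 + 8 * r * h2

theorem tNode_one_le (w : ChebKind) {n : ℕ} (hn : 0 < n) : tNode w n 1 ≤ π / nw w n := by
  rw [le_div_iff₀ (nw_pos w hn), mul_comm, nw_mul_tNode w hn]
  have := Real.pi_pos
  cases w <;> norm_num [trigSign] <;> linarith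

theorem trigDen_tNode_one_ge (w : ChebKind) {n : ℕ} (hn : 0 < n) :
    nw w n ^ (-((1 - trigSign w) / 2)) / 2 ≤ trigDen w (tNode w n 1) := by
  have hp := Real.pi_pos
  have hN := nw_pos w hn
  have hn1 : (1 : ℝ) ≤ n := by exact_mod_cast hn
  have h1 : 1 ≤ nw w n := by cases w <;> simp only [nw] <;> linarith
  have h2 := nw_mul_tNode w hn 1
  obtain ⟨k0, k1⟩ := tNode_mem w le_rfl hn
  have h3 : tNode w n 1 = (1 - (1 + trigSign w) / 4) * π / nw w n := by
    rw [eq_div_iff hN.ne']; push_cast at h2; linarith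
  cases w
  · norm_num [trigSign, trigDen]
  · have h4 : ((1 - trigSign .two) / 2) = 1 := by norm_num [trigSign]
    rw [h4, Real.rpow_neg_one]
    norm_num [trigSign] at h3
    have h5 := Real.mul_le_sin (x := tNode .two n 1) k0.le (by
      rw [h3]; gcongr; simp only [nw]; linarith)
    refine le_trans ?_ h5
    rw [h3]; field_simp; norm_num
  · have h5 : Real.cos (π / 3) ≤ Real.cos (tNode .three n 1 / 2) := by
      refine Real.cos_le_cos_of_nonneg_of_le_pi (by linarith) (by linarith) ?_
      norm_num [trigSign] at h3
      have : tNode .three n 1 ≤ π / 2 := by rw [h3]; exact (div_le_self (by positivity) h1).trans (by linarith)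
      linarith
    rw [Real.cos_pi_div_three] at h5
    norm_num [trigSign, trigDen]
    linarith
  · have h4 : ((1 - trigSign .four) / 2) = 1 := by norm_num [trigSign]
    rw [h4, Real.rpow_neg_one]
    norm_num [trigSign] at h3
    have h5 := Real.mul_le_sin (x := tNode .four n 1 / 2) (by linarith) (by linarith)
    refine le_trans ?_ h5
    rw [h3]; field_simp; norm_num

theorem jac_nonneg {γ δ x : ℝ} (hx : x ∈ Set.Icc (-1 : ℝ) 1) : 0 ≤ jac γ δ x :=
  mul_nonneg (Real.rpow_nonneg (by linarith [hx.2]) _) (Real.rpow_nonneg (by linarith [hx.1]) _)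

theorem jac_cos_pos {γ δ t : ℝ} (h0 : 0 < t) (h1 : t < π) : 0 < jac γ δ (Real.cos t) := by
  have h2 : Real.cos t < 1 := cos_lt_one_of_pos h0 (by linarith)
  have h3 : -1 < Real.cos t := by
    have := cos_lt_one_of_pos (s := π - t) (by linarith) (by linarith)
    rw [Real.cos_pi_sub] at this; linarith
  exact mul_pos (Real.rpow_pos_of_pos (by linarith) _) (Real.rpow_pos_of_pos (by linarith) _)

theorem jac_xNode_one_le (w : ChebKind) {n : ℕ} (hn : 0 < n) {γ δ : ℝ} (hγ : 0 ≤ γ)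
    (hδ : 0 ≤ δ) : jac γ δ (xNode w n 1) ≤ π ^ (2 * γ) * 2 ^ δ * nw w n ^ (-(2 * γ)) := by
  have hp := Real.pi_pos
  have hN := nw_pos w hn
  obtain ⟨k0, k1⟩ := tNode_mem w le_rfl hn
  have h1 := tNode_one_le w hn
  have h2 : 1 - xNode w n 1 ≤ (π / nw w n) ^ (2 : ℝ) := by
    have := Real.one_sub_sq_div_two_le_cos (x := tNode w n 1)
    rw [Real.rpow_two]
    unfold xNode
    nlinarith [sq_nonneg (tNode w n 1), pow_le_pow_left₀ k0.le h1 2]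
  have h3 : (1 - xNode w n 1) ^ γ ≤ (π / nw w n) ^ (2 * γ) := by
    rw [Real.rpow_mul (by positivity)]
    exact Real.rpow_le_rpow (by unfold xNode; linarith [Real.cos_le_one (tNode w n 1)]) h2 hγ
  have h4 : (1 + xNode w n 1) ^ δ ≤ 2 ^ δ := by
    refine Real.rpow_le_rpow ?_ ?_ hδ <;> unfold xNode
    · linarith [Real.neg_one_le_cos (tNode w n 1)]
    · linarith [Real.cos_le_one (tNode w n 1)]
  calc jac γ δ (xNode w n 1) ≤ (π / nw w n) ^ (2 * γ) * 2 ^ δ := by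
        unfold jac
        refine mul_le_mul h3 h4 (Real.rpow_nonneg ?_ _) (by positivity)
        unfold xNode; linarith [Real.neg_one_le_cos (tNode w n 1)]
    _ = _ := by
        rw [Real.div_rpow hp.le hN.le, Real.rpow_neg hN.le]; ring

theorem Admissible.first_term_ge (h : Admissible w r l n m q) (hr : 1 ≤ r) {γ δ : ℝ}
    (hγ : 0 ≤ γ) (hδ : 0 ≤ δ) {t : ℝ} (h0 : 0 < t) (h1 : t < π) (hne : t ≠ tNode w n 1)
    (ht : Real.sin (m * t) = 0) :
    Real.sin (firstPhase w r) / (4 * π ^ (2 * γ) * 2 ^ δ) *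
      nw w n ^ (2 * γ - 1 - (1 - trigSign w) / 2) * |trigNum w (nw w n * t)| *
      jac γ δ (Real.cos t) / (m * trigDen w t) ≤
    |Phi w n m 1 (Real.cos t)| * jac γ δ (Real.cos t) / jac γ δ (xNode w n 1) := by
  obtain ⟨-, hm, hn⟩ := h.pos hr
  have hp := Real.pi_pos
  have hN := nw_pos w hn
  have hm' : (0 : ℝ) < m := by exact_mod_cast hm
  obtain ⟨k0, k1⟩ := tNode_mem w le_rfl hn
  have hS := sin_firstPhase_pos w hr
  have hd := trigDen_pos w h0 h1
  have hj1 : 0 < jac γ δ (xNode w n 1) := jac_cos_pos k0 k1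
  have hj : 0 < jac γ δ (Real.cos t) := jac_cos_pos h0 h1
  rw [abs_Phi_cos w hm h.m_lt le_rfl hn h0 h1 hne ht, h.mul_tNode_one hr, abs_of_pos hS]
  have hQ : (1 : ℝ) ≤ 1 / (1 - Real.cos (t - tNode w n 1)) + 1 / (1 - Real.cos (t + tNode w n 1)) := by
    have a1 := cos_sub_lt_one k0 k1 h0 h1 hne
    have a2 := cos_lt_one_of_pos (s := t + tNode w n 1) (by linarith) (by linarith)
    have b1 : (1 : ℝ) / 2 ≤ 1 / (1 - Real.cos (t - tNode w n 1)) :=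
      one_div_le_one_div_of_le (by linarith) (by linarith [Real.neg_one_le_cos (t - tNode w n 1)])
    have b2 : (1 : ℝ) / 2 ≤ 1 / (1 - Real.cos (t + tNode w n 1)) :=
      one_div_le_one_div_of_le (by linarith) (by linarith [Real.neg_one_le_cos (t + tNode w n 1)])
    linarith
  generalize 1 / (1 - Real.cos (t - tNode w n 1)) + 1 / (1 - Real.cos (t + tNode w n 1)) = Q at hQ ⊢
  have hQ0 : 0 < Q := by linarith
  have hdk := trigDen_pos w k0 k1
  have hD := trigDen_tNode_one_ge w hn
  have hJ := jac_xNode_one_le w hn hγ hδ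
  have hpow : nw w n ^ (2 * γ - 1 - (1 - trigSign w) / 2) =
      nw w n ^ (-((1 - trigSign w) / 2)) / (nw w n * nw w n ^ (-(2 * γ))) := by
    rw [show 2 * γ - 1 - (1 - trigSign w) / 2 = -((1 - trigSign w) / 2) - 1 - (-(2 * γ)) by ring,
      Real.rpow_sub hN, Real.rpow_sub hN, Real.rpow_one, div_div]
  rw [hpow]
  set O := |trigNum w (nw w n * t)| with hO
  have hO0 : 0 ≤ O := abs_nonneg _
  have hA : 0 < nw w n ^ (-((1 - trigSign w) / 2)) := Real.rpow_pos_of_pos hN _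
  have hB : 0 < nw w n ^ (-(2 * γ)) := Real.rpow_pos_of_pos hN _
  have hP : 0 < π ^ (2 * γ) := Real.rpow_pos_of_pos hp _
  have h2δ : (0 : ℝ) < 2 ^ δ := Real.rpow_pos_of_pos two_pos _
  calc _ = (nw w n ^ (-((1 - trigSign w) / 2)) / 2 * O * Real.sin (firstPhase w r) /
        (2 * nw w n * m * trigDen w t) * 1) * jac γ δ (Real.cos t) /
        (π ^ (2 * γ) * 2 ^ δ * nw w n ^ (-(2 * γ))) := by field_simp; norm_num
    _ ≤ _ := by gcongr

end Admissible

theorem abs_trigNum_add_nat_mul_pi (w : ChebKind) (x : ℝ) (k : ℕ) :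
    |trigNum w (x + k * π)| = |trigNum w x| := by
  cases w <;> simp only [trigNum, Real.cos_add_nat_mul_pi, Real.sin_add_nat_mul_pi, abs_mul,
    abs_pow, abs_neg, abs_one, one_pow, one_mul]

/-- The weighted Lebesgue functions are nonnegative sums dominating each partial sum. -/
theorem sum_le_lebesgue_sum (w : ChebKind) (n m : ℕ) {γ δ x : ℝ} (hx : x ∈ Set.Icc (-1 : ℝ) 1)
    {s : Finset ℕ} (hs : s ⊆ Finset.Icc 1 n) :
    ∑ k ∈ s, |Phi w n m k x| * jac γ δ x / jac γ δ (xNode w n k) ≤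
      ∑ k ∈ Finset.Icc 1 n, |Phi w n m k x| * jac γ δ x / jac γ δ (xNode w n k) :=
  Finset.sum_le_sum_of_subset_of_nonneg hs fun _ _ _ =>
    div_nonneg (mul_nonneg (abs_nonneg _) (jac_nonneg hx))
      (jac_nonneg ⟨Real.neg_one_le_cos _, Real.cos_le_one _⟩)

/-- Unboundedness of the weighted Lebesgue constants. -/
def LebesgueUnbounded (w : ChebKind) (γ δ : ℝ) : Prop :=
  ∀ c1 : ℝ, 1 < c1 → ∀ M : ℝ, ∃ n m : ℕ, 0 < m ∧ m < n ∧ (n : ℝ) ≤ c1 * m ∧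
    ∃ x ∈ Set.Icc (-1 : ℝ) 1,
      M < ∑ k ∈ Finset.Icc 1 n, |Phi w n m k x| * jac γ δ x / jac γ δ (xNode w n k)

theorem lebesgueUnbounded_of_tendsto {w : ChebKind} {γ δ : ℝ}
    (H : ∀ r : ℕ, 4 ≤ r → ∃ F : ℕ → ℝ, Filter.Tendsto F Filter.atTop Filter.atTop ∧
      ∀ l n m q : ℕ, 1 ≤ l → Admissible w r l n m q → ∃ x ∈ Set.Icc (-1 : ℝ) 1, F l ≤
        ∑ k ∈ Finset.Icc 1 n, |Phi w n m k x| * jac γ δ x / jac γ δ (xNode w n k)) :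
    LebesgueUnbounded w γ δ := by
  intro c1 hc1 M
  obtain ⟨r0, hr0⟩ := exists_nat_gt (1 / (c1 - 1))
  obtain ⟨F, hF, hFs⟩ := H (r0 + 4) (by omega)
  obtain ⟨l, hl1, hl⟩ := ((Filter.eventually_ge_atTop 1).and (hF.eventually_gt_atTop M)).exists
  obtain ⟨n, m, q, h⟩ := exists_admissible w (r := r0 + 4) (by omega) hl1
  obtain ⟨x, hx, hxs⟩ := hFs l n m q hl1 h
  obtain ⟨-, hm, hn⟩ := h.pos (by omega)
  refine ⟨n, m, hm, h.m_lt, ?_, x, hx, hl.trans_le hxs⟩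
  have h1 := h.two_mul_mul_nw
  have h2 : (n : ℝ) ≤ nw w n := by cases w <;> simp only [nw] <;> linarith
  have hm' : (0 : ℝ) < m := by exact_mod_cast hm
  rw [div_lt_iff₀ (by linarith)] at hr0
  push_cast at h1
  have hr : (0 : ℝ) ≤ r0 := r0.cast_nonneg
  refine h2.trans ?_
  have h3 : 2 * ((r0 : ℝ) + 4) * nw w n ≤ 2 * ((r0 : ℝ) + 4) * (c1 * m) := by
    rw [h1]
    have : 2 * ((r0 : ℝ) + 4) + 1 ≤ 2 * ((r0 : ℝ) + 4) * c1 := by nlinarith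
    nlinarith
  exact le_of_mul_le_mul_left h3 (by positivity)

theorem lebesgueUnbounded_of_first_term {w : ChebKind} {γ δ κ : ℝ} (hκ : 0 < κ)
    (H : ∀ r : ℕ, 4 ≤ r → ∃ C : ℝ, 0 < C ∧
      ∀ l n m q : ℕ, 1 ≤ l → Admissible w r l n m q → ∃ x ∈ Set.Icc (-1 : ℝ) 1,
        C * nw w n ^ κ ≤ |Phi w n m 1 x| * jac γ δ x / jac γ δ (xNode w n 1)) :
    LebesgueUnbounded w γ δ := by
  refine lebesgueUnbounded_of_tendsto fun r hr => ?_
  obtain ⟨C, hC, HC⟩ := H r hr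
  refine ⟨fun l => C * (l : ℝ) ^ κ,
    ((tendsto_rpow_atTop hκ).comp tendsto_natCast_atTop_atTop).const_mul_atTop hC, ?_⟩
  intro l n m q hl h
  obtain ⟨x, hx, hxs⟩ := HC l n m q hl h
  obtain ⟨-, hm, hn⟩ := h.pos (by omega)
  refine ⟨x, hx, ?_⟩
  have h1 := sum_le_lebesgue_sum w n m (γ := γ) (δ := δ) hx (s := {1})
    (by simpa using (by omega : 1 ≤ n))
  rw [Finset.sum_singleton] at h1
  refine le_trans ?_ (hxs.trans h1)
  have := h.l_le_nw (by omega)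
  change C * (l : ℝ) ^ κ ≤ C * nw w n ^ κ
  gcongr

theorem Admissible.abs_trigNum_pi_div {w : ChebKind} {r l n m q : ℕ}
    (h : Admissible w r l n m q) (hr : 4 ≤ r) :
    |trigNum w (nw w n * (π / r))| = |trigNum w (freqBase w * (π / (2 * r)))| ∧
      0 < |trigNum w (freqBase w * (π / (2 * r)))| := by
  have hr' : (4 : ℝ) ≤ r := by exact_mod_cast hr
  have hr0 : (r : ℝ) ≠ 0 := by positivity
  have hp := Real.pi_pos
  constructor
  · rw [← abs_trigNum_add_nat_mul_pi w (freqBase w * (π / (2 * r))) (q + l)]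
    congr 2
    have h1 := h.two_mul_nw
    have h2 : (q : ℝ) = freqBase w + 2 * r * l := by exact_mod_cast h.q_eq
    push_cast
    field_simp
    linear_combination h1 + h2
  · have h1 : π / (2 * r) ≤ π / 8 := by gcongr; linarith
    have h2 : 0 < π / (2 * r) := by positivity
    rw [abs_pos]
    cases w <;> simp only [trigNum, freqBase] <;> push_cast
    · exact (Real.cos_pos_of_mem_Ioo ⟨by linarith, by linarith⟩).ne'
    · exact (Real.sin_pos_of_pos_of_lt_pi (by linarith) (by linarith)).ne'
    · exact (Real.cos_pos_of_mem_Ioo ⟨by linarith, by linarith⟩).ne'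
    · exact (Real.sin_pos_of_pos_of_lt_pi (by linarith) (by linarith)).ne'

theorem trigDen_le_one (w : ChebKind) (t : ℝ) : trigDen w t ≤ 1 := by
  cases w <;> simp only [trigDen, le_refl, Real.sin_le_one, Real.cos_le_one]

theorem Admissible.tNode_one_lt {w : ChebKind} {r l n m q : ℕ} (h : Admissible w r l n m q)
    (hr : 4 ≤ r) : tNode w n 1 < π / m := by
  obtain ⟨-, hm, hn⟩ := h.pos (by omega)
  have hm' : (0 : ℝ) < m := by exact_mod_cast hm
  have hr' : (4 : ℝ) ≤ r := by exact_mod_cast hr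
  refine (tNode_one_le w hn).trans_lt (div_lt_div_of_pos_left Real.pi_pos hm' ?_)
  have := h.two_mul_mul_nw
  nlinarith

/-- A single term of the Lebesgue sum blows up at interior points if `γ` is too large. -/
theorem lebesgueUnbounded_of_large_exponent {w : ChebKind} {γ δ : ℝ} (hγ : 0 ≤ γ) (hδ : 0 ≤ δ)
    (h : 2 + (1 - trigSign w) / 2 < 2 * γ) : LebesgueUnbounded w γ δ := by
  refine lebesgueUnbounded_of_first_term (κ := 2 * γ - 2 - (1 - trigSign w) / 2) (by linarith)
    fun r hr => ?_
  have hr' : (4 : ℝ) ≤ r := by exact_mod_cast hr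
  have hp := Real.pi_pos
  have hS := sin_firstPhase_pos w (r := r) (by omega)
  have ht0 : 0 < π / r := by positivity
  have ht1 : π / r < π := div_lt_self hp (by linarith)
  have hj : 0 < jac γ δ (Real.cos (π / r)) := jac_cos_pos ht0 ht1
  obtain ⟨n0, m0, q0, h0⟩ := exists_admissible w (r := r) (l := 1) (by omega) le_rfl
  have hO := (h0.abs_trigNum_pi_div hr).2
  refine ⟨Real.sin (firstPhase w r) / (4 * π ^ (2 * γ) * 2 ^ δ) *
    |trigNum w (freqBase w * (π / (2 * r)))| * jac γ δ (Real.cos (π / r)), by positivity, ?_⟩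
  intro l n m q hl h
  refine ⟨Real.cos (π / r), ⟨Real.neg_one_le_cos _, Real.cos_le_one _⟩, ?_⟩
  obtain ⟨hq, hm, hn⟩ := h.pos (by omega)
  have hN := nw_pos w hn
  have hm' : (0 : ℝ) < m := by exact_mod_cast hm
  have hmr : (m : ℝ) = r * q := by exact_mod_cast h.m_eq
  have hq' : (1 : ℝ) ≤ q := by exact_mod_cast hq
  have hne : π / r ≠ tNode w n 1 := by
    refine ((h.tNode_one_lt hr).trans_le ?_).ne'
    gcongr
    rw [h.m_eq]; exact Nat.le_mul_of_pos_right r hq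
  have ht : Real.sin (m * (π / r)) = 0 := by
    rw [hmr, show (r : ℝ) * q * (π / r) = q * π by field_simp]
    exact Real.sin_nat_mul_pi q
  refine le_trans ?_ (h.first_term_ge (by omega) hγ hδ ht0 ht1 hne ht)
  rw [(h.abs_trigNum_pi_div hr).1]
  have hd := trigDen_pos w ht0 ht1
  have hmd : (m : ℝ) * trigDen w (π / r) ≤ nw w n := by
    have := h.le_nw (by omega)
    nlinarith [trigDen_le_one w (π / r)]
  rw [show 2 * γ - 2 - (1 - trigSign w) / 2 = 2 * γ - 1 - (1 - trigSign w) / 2 - 1 by ring,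
    Real.rpow_sub_one hN.ne']
  have hpow : 0 < nw w n ^ (2 * γ - 1 - (1 - trigSign w) / 2) := Real.rpow_pos_of_pos hN _
  generalize nw w n ^ (2 * γ - 1 - (1 - trigSign w) / 2) = A at hpow ⊢
  calc _ = Real.sin (firstPhase w r) / (4 * π ^ (2 * γ) * 2 ^ δ) * A *
        |trigNum w (freqBase w * (π / (2 * r)))| * jac γ δ (Real.cos (π / r)) / nw w n := by
        ring
    _ ≤ _ := by gcongr

/-- A single term of the Lebesgue sum blows up near `-1` if `γ - δ` is too large. -/
theorem lebesgueUnbounded_of_large_diff {w : ChebKind} (hw : w = .two ∨ w = .three) {γ δ : ℝ}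
    (hγ : 0 ≤ γ) (hδ : 0 ≤ δ) (h : 1 + (1 - trigSign w) / 2 < 2 * (γ - δ)) :
    LebesgueUnbounded w γ δ := by
  refine lebesgueUnbounded_of_first_term (κ := 2 * γ - 1 - (1 - trigSign w) / 2 - 2 * δ)
    (by linarith) fun r hr => ?_
  have hr' : (4 : ℝ) ≤ r := by exact_mod_cast hr
  have hp := Real.pi_pos
  have hS := sin_firstPhase_pos w (r := r) (by omega)
  have hO : 0 < Real.sin (π / (2 * r)) :=
    Real.sin_pos_of_pos_of_lt_pi (by positivity) (div_lt_self hp (by linarith))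
  refine ⟨Real.sin (firstPhase w r) / (4 * π ^ (2 * γ) * 2 ^ δ) *
    Real.sin (π / (2 * r)) / π, by positivity, ?_⟩
  intro l n m q hl h
  refine ⟨Real.cos (π - π / m), ⟨Real.neg_one_le_cos _, Real.cos_le_one _⟩, ?_⟩
  obtain ⟨hq, hm, hn⟩ := h.pos (by omega)
  have hN := nw_pos w hn
  have hm' : (0 : ℝ) < m := by exact_mod_cast hm
  have hmr : (m : ℝ) = r * q := by exact_mod_cast h.m_eq
  have hq' : (1 : ℝ) ≤ q := by exact_mod_cast hq
  have hm4 : (4 : ℝ) ≤ m := by rw [hmr]; nlinarith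
  have hpm : π / m ≤ π / 4 := by gcongr
  have hpm0 : 0 < π / m := by positivity
  have hne : π - π / m ≠ tNode w n 1 := by
    have := h.tNode_one_lt hr
    intro h'; linarith
  have ht : Real.sin (m * (π - π / m)) = 0 := by
    rw [show (m : ℝ) * (π - π / m) = m * π - π by field_simp, Real.sin_sub_pi,
      Real.sin_nat_mul_pi, neg_zero]
  have ht0 : 0 < π - π / m := by linarith
  have ht1 : π - π / m < π := by linarith
  refine le_trans ?_ (h.first_term_ge (by omega) hγ hδ ht0 ht1 hne ht)
  have hd := trigDen_pos w ht0 ht1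
  have hmd : (m : ℝ) * trigDen w (π - π / m) ≤ π := by
    have h1 : trigDen w (π - π / m) ≤ π / m := by
      rcases hw with rfl | rfl
      · simp only [trigDen, Real.sin_pi_sub]; exact Real.sin_le hpm0.le
      · simp only [trigDen]
        rw [show (π - π / m) / 2 = π / 2 - π / m / 2 by ring, Real.cos_pi_div_two_sub]
        exact (Real.sin_le (by positivity)).trans (by linarith)
    calc (m : ℝ) * trigDen w (π - π / m) ≤ m * (π / m) := by gcongr
      _ = π := by field_simp
  have hNt : nw w n * (π - π / m) = nw w n * π - π - π / (2 * r) := by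
    have := h.two_mul_mul_nw
    field_simp
    linear_combination -this
  have hnum : |trigNum w (nw w n * (π - π / m))| = Real.sin (π / (2 * r)) := by
    rw [hNt, ← abs_of_pos hO]
    rcases hw with rfl | rfl
    · simp only [trigNum, nw]
      rw [show ((n : ℝ) + 1) * π - π - π / (2 * r) = n * π - π / (2 * r) by ring,
        Real.sin_nat_mul_pi_sub]
      simp [abs_mul, abs_of_pos hO]
    · simp only [trigNum, nw]
      rw [show (2 * (n : ℝ) + 1) / 2 * π - π - π / (2 * r) = n * π - π / (2 * r) - π / 2 by ring,
        Real.cos_sub_pi_div_two, Real.sin_nat_mul_pi_sub]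
      simp [abs_mul, abs_of_pos hO]
  have hjac : nw w n ^ (-(2 * δ)) ≤ jac γ δ (Real.cos (π - π / m)) := by
    unfold jac
    rw [Real.cos_pi_sub, show -(2 * δ) = (-2 : ℝ) * δ by ring, Real.rpow_mul hN.le]
    have c1 : 0 ≤ Real.cos (π / m) := Real.cos_nonneg_of_mem_Icc ⟨by linarith, by linarith⟩
    have c2 : nw w n ^ (-2 : ℝ) ≤ 1 + -Real.cos (π / m) := by
      have h1 := Real.cos_le_one_sub_mul_cos_sq (x := π / m)
        (by rw [abs_of_pos hpm0]; linarith)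
      rw [show 2 / π ^ 2 * (π / m) ^ 2 = 2 / (m : ℝ) ^ 2 by field_simp] at h1
      have h2 := h.le_nw (by omega)
      have h3 : 1 / nw w n ^ 2 ≤ 1 / (m : ℝ) ^ 2 := by gcongr
      rw [Real.rpow_neg hN.le, Real.rpow_two, inv_eq_one_div]
      have h4 : 2 / (m : ℝ) ^ 2 = 1 / (m : ℝ) ^ 2 + 1 / (m : ℝ) ^ 2 := by ring
      have h5 : 0 < 1 / (m : ℝ) ^ 2 := by positivity
      rw [h4] at h1
      linarith
    calc (nw w n ^ (-2 : ℝ)) ^ δ ≤ (1 + -Real.cos (π / m)) ^ δ :=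
          Real.rpow_le_rpow (by positivity) c2 hδ
      _ = 1 * (1 + -Real.cos (π / m)) ^ δ := (one_mul _).symm
      _ ≤ _ := by
        gcongr
        · exact Real.rpow_nonneg (by linarith [Real.cos_le_one (π / m)]) _
        · exact Real.one_le_rpow (by linarith) hγ
  rw [hnum, Real.rpow_sub hN (2 * γ - 1 - (1 - trigSign w) / 2)]
  rw [Real.rpow_neg hN.le] at hjac
  have hpow : 0 < nw w n ^ (2 * γ - 1 - (1 - trigSign w) / 2) := Real.rpow_pos_of_pos hN _
  have hpow2 : 0 < nw w n ^ (2 * δ) := Real.rpow_pos_of_pos hN _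
  generalize nw w n ^ (2 * γ - 1 - (1 - trigSign w) / 2) = A at hpow ⊢
  have hj0 : 0 < jac γ δ (Real.cos (π - π / m)) := jac_cos_pos ht0 ht1
  calc _ = Real.sin (firstPhase w r) / (4 * π ^ (2 * γ) * 2 ^ δ) * A *
        Real.sin (π / (2 * r)) * (nw w n ^ (2 * δ))⁻¹ / π := by
        ring
    _ ≤ _ := by gcongr

theorem two_mul_mul_trigDen_le {w : ChebKind} (hw : w = .two ∨ w = .four) {t s : ℝ}
    (ht0 : 0 ≤ t) (hs0 : 0 ≤ s) (hs : s ≤ π / 2) :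
    2 * s * trigDen w t ≤ π * t * trigDen w s := by
  have hp := Real.pi_pos
  rcases hw with rfl | rfl <;> simp only [trigDen]
  · have h1 := Real.mul_le_sin hs0 hs
    rw [div_mul_eq_mul_div, div_le_iff₀ hp] at h1
    have h2 := Real.sin_le ht0
    calc 2 * s * Real.sin t ≤ 2 * s * t := by gcongr
      _ ≤ Real.sin s * π * t := by gcongr
      _ = _ := by ring
  · have h1 := Real.mul_le_sin (x := s / 2) (by linarith) (by linarith)
    rw [div_mul_eq_mul_div, div_le_iff₀ hp] at h1
    have h2 := Real.sin_le (x := t / 2) (by linarith)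
    calc 2 * s * Real.sin (t / 2) ≤ 2 * s * (t / 2) := by gcongr
      _ = 2 * (s / 2) * t := by ring
      _ ≤ Real.sin (s / 2) * π * t := by gcongr
      _ = _ := by ring

/-- For the second and fourth weights, the fundamental polynomials of every `(2 r + 1)`-th node
decay only harmonically at the point `cos (π / m)`. -/
theorem Admissible.Phi_ge_harmonic {w : ChebKind} (hw : w = .two ∨ w = .four) {r l n m q : ℕ}
    (h : Admissible w r l n m q) (hr : 4 ≤ r) {i : ℕ} (hi : i < l) :
    1 + (2 * r + 1) * (i + 1) ≤ n ∧ π / m < tNode w n (1 + (2 * r + 1) * (i + 1)) ∧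
      2 * Real.sin (π / (2 * r)) * Real.sin (firstPhase w r) / (π ^ 3 * (2 * r + 2)) *
        (1 / ((i : ℝ) + 1)) ≤
      |Phi w n m (1 + (2 * r + 1) * (i + 1)) (Real.cos (π / m))| := by
  obtain ⟨hq, hm, hn⟩ := h.pos (by omega)
  have hp := Real.pi_pos
  have hr' : (4 : ℝ) ≤ r := by exact_mod_cast hr
  have hm' : (0 : ℝ) < m := by exact_mod_cast hm
  have hN := nw_pos w hn
  have hsign : trigSign w = -1 := by rcases hw with rfl | rfl <;> rfl
  have hbase : 2 ≤ freqBase w := by rcases hw with rfl | rfl <;> simp [freqBase]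
  have hnw : nw w n ≤ n + 1 := by rcases hw with rfl | rfl <;> simp only [nw] <;> linarith
  have hk2 : 2 ≤ 1 + (2 * r + 1) * (i + 1) := by nlinarith
  have hk4 : 4 * (1 + (2 * r + 1) * (i + 1)) ≤ (2 * r + 1) * q := by
    rw [h.q_eq]
    calc 4 * (1 + (2 * r + 1) * (i + 1)) = 4 + (2 * r + 1) * (4 * (i + 1)) := by ring
      _ ≤ (2 * r + 1) * 2 + (2 * r + 1) * (2 * r * l) := by
        gcongr
        · omega
        · omega
        · omega
      _ ≤ (2 * r + 1) * (freqBase w + 2 * r * l) := by nlinarith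
  have hkle : ((1 + (2 * r + 1) * (i + 1) : ℕ) : ℝ) ≤ (2 * r + 2) * (i + 1) := by
    push_cast; nlinarith [i.cast_nonneg (α := ℝ)]
  have hkdef : ((1 + (2 * r + 1) * (i + 1) : ℕ) : ℝ) = 1 + (2 * r + 1) * (i + 1) := by
    push_cast; ring
  generalize 1 + (2 * r + 1) * (i + 1) = k at *
  have hk2' : (2 : ℝ) ≤ k := by exact_mod_cast hk2
  have hkN : 2 * (k : ℝ) ≤ nw w n := by
    have h1 : 4 * (k : ℝ) ≤ (2 * r + 1) * q := by exact_mod_cast hk4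
    linarith [h.two_mul_nw]
  have hkn : k ≤ n := by
    have h1 : 2 * (k : ℝ) ≤ n + 1 := by linarith
    have h2 : 2 * k ≤ n + 1 := by exact_mod_cast h1
    omega
  have hs := nw_mul_tNode w hn k
  rw [hsign] at hs
  norm_num at hs
  obtain ⟨s0, s1⟩ := tNode_mem w (by omega : 1 ≤ k) hkn
  have hNm := h.two_mul_mul_nw
  have hmt : (m : ℝ) * (π / m) = π := by field_simp
  have hNt : nw w n * (π / m) = π / (2 * r) + π := by
    field_simp
    linear_combination hNm
  have hms : m * tNode w n k = firstPhase w r + (r * (i + 1) : ℕ) * (2 * π) := by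
    have h1 : (2 * r + 1) * (m * tNode w n k) = 2 * r * (k * π) := by
      linear_combination (-tNode w n k) * hNm + 2 * r * hs
    unfold firstPhase
    rw [hsign]
    push_cast
    rw [hkdef] at h1
    field_simp
    linear_combination 4 * h1
  have ht0 : 0 < π / m := by positivity
  have hr2 : π / (2 * r) ≤ π / 8 := by gcongr; linarith
  have hr0 : 0 < π / (2 * r) := by positivity
  generalize π / (m : ℝ) = t at *
  have hts : t < tNode w n k := by
    refine lt_of_mul_lt_mul_left ?_ hN.le
    rw [hNt, hs]
    nlinarith
  have hs2 : tNode w n k ≤ π / 2 := by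
    refine le_of_mul_le_mul_left ?_ hN
    rw [hs]
    nlinarith
  refine ⟨hkn, hts, ?_⟩
  have hO : 0 < Real.sin (π / (2 * r)) := Real.sin_pos_of_pos_of_lt_pi hr0 (by linarith)
  have hS := sin_firstPhase_pos w (r := r) (by omega)
  have hnum : |trigNum w (nw w n * t)| = Real.sin (π / (2 * r)) := by
    rw [hNt, ← abs_of_pos hO, ← abs_neg (Real.sin _), ← Real.sin_add_pi]
    rcases hw with rfl | rfl <;> rfl
  rw [abs_Phi_cos w hm h.m_lt (by omega) hkn ht0 (by linarith) hts.ne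
    (by rw [hmt, Real.sin_pi]), hnum, hms, Real.sin_add_nat_mul_two_pi, abs_of_pos hS]
  have hdt := trigDen_pos w ht0 (by linarith)
  have hratio : 2 * tNode w n k * trigDen w t ≤ π * t * trigDen w (tNode w n k) :=
    two_mul_mul_trigDen_le hw ht0.le s0.le hs2
  have hQ : 2 / tNode w n k ^ 2 ≤ 1 / (1 - Real.cos (t - tNode w n k)) +
      1 / (1 - Real.cos (t + tNode w n k)) := by
    have a1 := cos_sub_lt_one s0 s1 ht0 (by linarith) hts.ne
    have a2 := cos_lt_one_of_pos (s := t + tNode w n k) (by linarith) (by linarith)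
    have a3 := Real.one_sub_sq_div_two_le_cos (x := t - tNode w n k)
    have b2 : 0 ≤ 1 / (1 - Real.cos (t + tNode w n k)) := by
      have : 0 < 1 - Real.cos (t + tNode w n k) := by linarith
      positivity
    have b1 : 2 / tNode w n k ^ 2 ≤ 1 / (1 - Real.cos (t - tNode w n k)) := by
      rw [div_le_div_iff₀ (by positivity) (by linarith)]
      nlinarith
    linarith
  generalize 1 / (1 - Real.cos (t - tNode w n k)) + 1 / (1 - Real.cos (t + tNode w n k)) = Q
    at hQ ⊢
  generalize tNode w n k = s at *
  generalize Real.sin (π / (2 * r)) = O at *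
  generalize Real.sin (firstPhase w r) = S at *
  have hk0 : (0 : ℝ) < k := by linarith
  have hsk : s = k * π / nw w n := by rw [eq_div_iff hN.ne']; linarith
  have htm : t = π / m := by rw [eq_div_iff hm'.ne']; linarith
  have hds := trigDen_pos w s0 s1
  have hD : 2 * s / (π * t) ≤ trigDen w s / trigDen w t := by
    rw [div_le_div_iff₀ (by positivity) hdt]
    linarith
  calc 2 * O * S / (π ^ 3 * (2 * r + 2)) * (1 / ((i : ℝ) + 1))
      = 2 * O * S / (π ^ 3 * ((2 * r + 2) * (i + 1))) := by field_simp
    _ ≤ 2 * O * S / (π ^ 3 * k) := by gcongr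
    _ = 2 * s / (π * t) * (O * S / (2 * nw w n * m)) * (2 / s ^ 2) := by
        rw [htm, hsk]; field_simp
    _ ≤ trigDen w s / trigDen w t * (O * S / (2 * nw w n * m)) * Q := by gcongr
    _ = _ := by field_simp

theorem lebesgueUnbounded_of_zero_exponent {w : ChebKind} (hw : w = .two ∨ w = .four) {δ : ℝ}
    (hδ : 0 ≤ δ) : LebesgueUnbounded w 0 δ := by
  refine lebesgueUnbounded_of_tendsto fun r hr => ?_
  have hr' : (4 : ℝ) ≤ r := by exact_mod_cast hr
  have hp := Real.pi_pos
  have hO : 0 < Real.sin (π / (2 * r)) :=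
    Real.sin_pos_of_pos_of_lt_pi (by positivity) (div_lt_self hp (by linarith))
  have hS := sin_firstPhase_pos w (r := r) (by omega)
  refine ⟨_, Real.tendsto_sum_range_one_div_nat_succ_atTop.const_mul_atTop
    (show 0 < 2 * Real.sin (π / (2 * r)) * Real.sin (firstPhase w r) / (π ^ 3 * (2 * r + 2)) by
      positivity), ?_⟩
  intro l n m q hl h
  have hx : Real.cos (π / m) ∈ Set.Icc (-1 : ℝ) 1 := ⟨Real.neg_one_le_cos _, Real.cos_le_one _⟩
  obtain ⟨hq, hm, hn⟩ := h.pos (by omega)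
  have hm' : (0 : ℝ) < m := by exact_mod_cast hm
  refine ⟨_, hx, ?_⟩
  have hinj : Set.InjOn (fun i : ℕ => 1 + (2 * r + 1) * (i + 1)) (Finset.range l) := by
    intro a _ b _ hab
    simpa using hab
  refine le_trans ?_ (sum_le_lebesgue_sum w n m hx
    (s := (Finset.range l).image fun i : ℕ => 1 + (2 * r + 1) * (i + 1)) ?_)
  · rw [Finset.sum_image hinj, Finset.mul_sum]
    refine Finset.sum_le_sum fun i hi => ?_
    obtain ⟨hkn, hts, hPhi⟩ := h.Phi_ge_harmonic hw hr (Finset.mem_range.1 hi)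
    refine hPhi.trans ?_
    obtain ⟨s0, s1⟩ := tNode_mem w (by omega : 1 ≤ 1 + (2 * r + 1) * (i + 1)) hkn
    have hj : 0 < jac 0 δ (xNode w n (1 + (2 * r + 1) * (i + 1))) := jac_cos_pos s0 s1
    rw [le_div_iff₀ hj]
    refine mul_le_mul_of_nonneg_left ?_ (abs_nonneg _)
    have hcos := Real.cos_le_cos_of_nonneg_of_le_pi (by positivity) s1.le hts.le
    simp only [jac, xNode, Real.rpow_zero, one_mul]
    exact Real.rpow_le_rpow (by linarith [Real.neg_one_le_cos (tNode w n (1 + (2 * r + 1) * (i + 1)))])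
      (by linarith) hδ
  · intro k hk
    obtain ⟨i, hi, rfl⟩ := Finset.mem_image.1 hk
    exact Finset.mem_Icc.2 ⟨by omega, (h.Phi_ge_harmonic hw hr (Finset.mem_range.1 hi)).1⟩

/-- The Chebyshev weight obtained by the reflection `x ↦ -x`. -/
def ChebKind.mirror : ChebKind → ChebKind
  | .one => .one | .two => .two | .three => .four | .four => .three

theorem pEval_mirror_neg (w : ChebKind) (j : ℕ) (x : ℝ) :
    pEval w.mirror j (-x) = (-1) ^ j * pEval w j x := by
  have hsgn : ∀ j : ℕ, (((j : ℤ).negOnePow : ℤ) : ℝ) = (-1) ^ j := fun j => by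
    simp [Int.negOnePow_def]
  have hT : ∀ j : ℕ, (Polynomial.Chebyshev.T ℝ (j : ℤ)).eval (-x) =
      (-1) ^ j * (Polynomial.Chebyshev.T ℝ (j : ℤ)).eval x := fun j => by
    rw [Polynomial.Chebyshev.T_eval_neg, hsgn]
  have hU : ∀ j : ℕ, (Polynomial.Chebyshev.U ℝ (j : ℤ)).eval (-x) =
      (-1) ^ j * (Polynomial.Chebyshev.U ℝ (j : ℤ)).eval x := fun j => by
    rw [Polynomial.Chebyshev.U_eval_neg, hsgn]
  have hU' : ∀ j : ℕ, (Polynomial.Chebyshev.U ℝ ((j : ℤ) - 1)).eval (-x) =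
      -((-1) ^ j * (Polynomial.Chebyshev.U ℝ ((j : ℤ) - 1)).eval x) := by
    rintro (_ | j)
    · simp
    · have h := hU j
      push_cast
      rw [add_sub_cancel_right, h, pow_succ]
      ring
  unfold pEval
  cases w
  · cases j with
    | zero => simp [ChebKind.mirror, pPoly]
    | succ j =>
      have h := hT (j + 1)
      push_cast at h
      simp only [ChebKind.mirror, pPoly, Polynomial.eval_mul, Polynomial.eval_C, h]
      ring
  all_goals
    simp only [ChebKind.mirror, pPoly, Polynomial.eval_mul, Polynomial.eval_C,
      Polynomial.eval_sub, Polynomial.eval_add, hU, hU']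
    ring

theorem tNode_mirror (w : ChebKind) {n k : ℕ} (hn : 0 < n) (hk : k ≤ n) :
    tNode w.mirror n (n + 1 - k) = π - tNode w n k := by
  have h : ((n + 1 - k : ℕ) : ℝ) = n + 1 - k := by
    rw [Nat.cast_sub (by omega)]; push_cast; ring
  have hn' : (0 : ℝ) < n := by exact_mod_cast hn
  cases w <;> simp only [ChebKind.mirror, tNode, h] <;> field_simp <;> ring

theorem xNode_mirror (w : ChebKind) {n k : ℕ} (hn : 0 < n) (hk : k ≤ n) :
    xNode w.mirror n (n + 1 - k) = -xNode w n k := by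
  rw [xNode, tNode_mirror w hn hk, Real.cos_pi_sub, xNode]

theorem lam_mirror (w : ChebKind) {n k : ℕ} (hn : 0 < n) (hk : k ≤ n) :
    lam w.mirror n (n + 1 - k) = lam w n k := by
  have h := tNode_mirror w hn hk
  have hs : ∀ t : ℝ, (π - t) / 2 = π / 2 - t / 2 := fun t => by ring
  cases w <;> simp only [ChebKind.mirror] at h <;> simp only [ChebKind.mirror, lam, h, hs,
    Real.sin_pi_sub, Real.cos_pi_div_two_sub, Real.sin_pi_div_two_sub]

theorem Phi_mirror (w : ChebKind) {n m k : ℕ} (hn : 0 < n) (hk : k ≤ n) (x : ℝ) :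
    Phi w.mirror n m (n + 1 - k) (-x) = Phi w n m k x := by
  unfold Phi
  rw [lam_mirror w hn hk, xNode_mirror w hn hk]
  congr 1
  refine Finset.sum_congr rfl fun j _ => ?_
  rw [pEval_mirror_neg, pEval_mirror_neg]
  have h : ((-1 : ℝ) ^ j) * (-1) ^ j = 1 := by rw [← mul_pow]; norm_num
  linear_combination (mufilt n m j * pEval w j (xNode w n k) * pEval w j x) * h

theorem jac_neg (γ δ x : ℝ) : jac δ γ (-x) = jac γ δ x := by
  unfold jac
  rw [sub_neg_eq_add, ← sub_eq_add_neg, mul_comm]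

theorem LebesgueUnbounded.of_mirror {w : ChebKind} {γ δ : ℝ}
    (h : LebesgueUnbounded w.mirror δ γ) : LebesgueUnbounded w γ δ := by
  intro c1 hc1 M
  obtain ⟨n, m, hm, hmn, hc, x, hx, hM⟩ := h c1 hc1 M
  refine ⟨n, m, hm, hmn, hc, -x, ⟨by linarith [hx.2], by linarith [hx.1]⟩, hM.trans_eq ?_⟩
  symm
  refine Finset.sum_nbij' (fun k => n + 1 - k) (fun k => n + 1 - k) ?_ ?_ ?_ ?_ ?_
  · intro k hk; simp only [Finset.mem_Icc] at hk ⊢; omega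
  · intro k hk; simp only [Finset.mem_Icc] at hk ⊢; omega
  · intro k hk; simp only [Finset.mem_Icc] at hk; omega
  · intro k hk; simp only [Finset.mem_Icc] at hk; omega
  · intro k hk
    have hkn := (Finset.mem_Icc.1 hk).2
    have hn : 0 < n := by omega
    rw [← Phi_mirror w hn hkn, xNode_mirror w hn hkn, ← jac_neg δ γ x, jac_neg γ δ, neg_neg]

/-- if (hp-u) fails, the weighted Lebesgue constants are unbounded
over the pairs `0 < m < n ≤ c1·m`. -/
theorem stmt1 (w : ChebKind) (γ δ : ℝ) (hγ : 0 ≤ γ) (hδ : 0 ≤ δ) (hu : ¬ hpu w γ δ) :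
    ∀ c1 : ℝ, 1 < c1 → ∀ M : ℝ, ∃ n m : ℕ, 0 < m ∧ m < n ∧ (n : ℝ) ≤ c1 * m ∧
      ∃ x ∈ Set.Icc (-1 : ℝ) 1,
        M < ∑ k ∈ Finset.Icc 1 n, |Phi w n m k x| * jac γ δ x / jac γ δ (xNode w n k) := by
  change LebesgueUnbounded w γ δ
  cases w
  · have h : 1 < γ ∨ 1 < δ := by
      by_contra! h'
      exact hu ⟨hγ, h'.1, hδ, h'.2⟩
    rcases h with h | h
    · exact lebesgueUnbounded_of_large_exponent hγ hδ (by norm_num [trigSign]; linarith)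
    · exact .of_mirror (lebesgueUnbounded_of_large_exponent hδ hγ
        (by norm_num [trigSign, ChebKind.mirror]; linarith))
  · have h : γ = 0 ∨ δ = 0 ∨ 3 / 2 < γ ∨ 3 / 2 < δ ∨ 1 < γ - δ ∨ 1 < δ - γ := by
      by_contra! h'
      obtain ⟨h1, h2, h3, h4, h5, h6⟩ := h'
      exact hu ⟨hγ.lt_of_ne' h1, h3, hδ.lt_of_ne' h2, h4, by linarith, h5⟩
    rcases h with rfl | rfl | h | h | h | h
    · exact lebesgueUnbounded_of_zero_exponent (.inl rfl) hδ
    · exact .of_mirror (lebesgueUnbounded_of_zero_exponent (.inl rfl) hγ)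
    · exact lebesgueUnbounded_of_large_exponent hγ hδ (by norm_num [trigSign]; linarith)
    · exact .of_mirror (lebesgueUnbounded_of_large_exponent hδ hγ
        (by norm_num [trigSign, ChebKind.mirror]; linarith))
    · exact lebesgueUnbounded_of_large_diff (.inl rfl) hγ hδ (by norm_num [trigSign]; linarith)
    · exact .of_mirror (lebesgueUnbounded_of_large_diff (.inl rfl) hδ hγ
        (by norm_num [trigSign, ChebKind.mirror]; linarith))
  · have h : δ = 0 ∨ 1 < γ ∨ 3 / 2 < δ ∨ 1 / 2 < γ - δ := by
      by_contra! h'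
      obtain ⟨h1, h2, h3, h4⟩ := h'
      exact hu ⟨hγ, h2, hδ.lt_of_ne' h1, h3, h4⟩
    rcases h with rfl | h | h | h
    · exact .of_mirror (lebesgueUnbounded_of_zero_exponent (.inr rfl) hγ)
    · exact lebesgueUnbounded_of_large_exponent hγ hδ (by norm_num [trigSign]; linarith)
    · exact .of_mirror (lebesgueUnbounded_of_large_exponent hδ hγ
        (by norm_num [trigSign, ChebKind.mirror]; linarith))
    · exact lebesgueUnbounded_of_large_diff (.inr rfl) hγ hδ (by norm_num [trigSign]; linarith)
  · have h : γ = 0 ∨ 1 < δ ∨ 3 / 2 < γ ∨ 1 / 2 < δ - γ := by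
      by_contra! h'
      obtain ⟨h1, h2, h3, h4⟩ := h'
      exact hu ⟨hγ.lt_of_ne' h1, h3, hδ, h2, by linarith⟩
    rcases h with rfl | h | h | h
    · exact lebesgueUnbounded_of_zero_exponent (.inr rfl) hδ
    · exact .of_mirror (lebesgueUnbounded_of_large_exponent hδ hγ
        (by norm_num [trigSign, ChebKind.mirror]; linarith))
    · exact lebesgueUnbounded_of_large_exponent hγ hδ (by norm_num [trigSign]; linarith)
    · exact .of_mirror (lebesgueUnbounded_of_large_diff (.inr rfl) hδ hγ
        (by norm_num [trigSign, ChebKind.mirror]; linarith))
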